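/- For G a centered Gaussian vector in ℝⁿ with covariance matrix Σ and f ∈ C²(ℝⁿ) with f and its first two derivatives of polynomial growth, the Ornstein–Uhlenbeck semigroup P_t f(x) = E[f(e^{-t} x + √(1-e^{-2t}) G)] satisfies the Stein equation: for all x ∈ ℝⁿ, f(x) − E[f(G)] = ∫₀^∞ ( ⟨x, ∇P_t f(x)⟩ − ⟨Σ, ∇² P_t f(x)⟩_{H.S.} ) dt, where ⟨A,B⟩_{H.S.} = Tr(A Bᵗ). -/

import Mathlib

open MeasureTheory ProbabilityTheory Real Finset

variable {n : ℕ} {Ω : Type*} [MeasurableSpace Ω]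

/-- The Ornstein–Uhlenbeck semigroup `P_t f (x) = E[f(e^{-t} x + √(1-e^{-2t}) G)]`. -/
noncomputable def ouSem (P : Measure Ω) (G : Ω → Fin n → ℝ)
    (f : (Fin n → ℝ) → ℝ) (t : ℝ) (x : Fin n → ℝ) : ℝ :=
  ∫ ω, f (Real.exp (-t) • x + Real.sqrt (1 - Real.exp (-2 * t)) • G ω) ∂P


section aux
open Matrix Filter Topology
open scoped ENNReal NNReal

/-- Polynomial growth. -/
def PolyG {E F : Type*} [NormedAddCommGroup E] [NormedAddCommGroup F] (h : E → F) : Prop :=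
  ∃ (C : ℝ) (p : ℕ), 0 ≤ C ∧ ∀ x, ‖h x‖ ≤ C * (1 + ‖x‖) ^ p

section poly
variable {E E' F : Type*} [NormedAddCommGroup E] [NormedAddCommGroup E'] [NormedAddCommGroup F]

lemma PolyG.of_le {F' : Type*} [NormedAddCommGroup F'] {h : E → F} (hh : PolyG h) {k : E → F'}
    (hk : ∀ x, ‖k x‖ ≤ ‖h x‖) : PolyG k := by
  obtain ⟨C, p, hC, H⟩ := hh
  exact ⟨C, p, hC, fun x => (hk x).trans (H x)⟩

/-- composition with maps of linear growth -/
lemma PolyG.comp {h : E → F} (hh : PolyG h) {g : E' → E} (K : ℝ) (hK : 0 ≤ K)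
    (hg : ∀ x, ‖g x‖ ≤ K * (1 + ‖x‖)) : PolyG (fun x => h (g x)) := by
  obtain ⟨C, p, hC, H⟩ := hh
  refine ⟨C * (1 + K) ^ p, p, by positivity, fun x => (H _).trans ?_⟩
  rw [mul_assoc, ← mul_pow]
  gcongr
  nlinarith [hg x, norm_nonneg x]

lemma PolyG.mul {h k : E → ℝ} (hh : PolyG h) (hk : PolyG k) : PolyG (fun x => h x * k x) := by
  obtain ⟨C, p, hC, H⟩ := hh
  obtain ⟨C', p', hC', H'⟩ := hk
  refine ⟨C * C', p + p', by positivity, fun x => ?_⟩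
  rw [norm_mul]
  calc ‖h x‖ * ‖k x‖ ≤ (C * (1 + ‖x‖) ^ p) * (C' * (1 + ‖x‖) ^ p') := by
        gcongr
        · exact H x
        · exact H' x
    _ = _ := by ring

lemma PolyG.norm_id : PolyG (fun x : E => x) :=
  ⟨1, 1, zero_le_one, fun x => by simp⟩

lemma integrable_one_add_pow [MeasurableSpace E] {μ : Measure E} [IsFiniteMeasure μ]
    [BorelSpace E] [SecondCountableTopology E]
    (hμ : ∀ p : ℕ, MemLp id (p : ℝ≥0∞) μ) (p : ℕ) (c : ℝ) :
    Integrable (fun x : E => (c + ‖x‖) ^ p) μ := by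
  have h1 : MemLp (fun x : E => c + ‖x‖) (p : ℝ≥0∞) μ :=
    (memLp_const c).add (hμ p).norm
  rcases Nat.eq_zero_or_pos p with rfl | hp
  · simp
  have := (integrable_norm_rpow_iff h1.1 (by simp [hp.ne']) (by simp)).2 h1
  refine this.mono (by fun_prop) (ae_of_all _ fun x => ?_)
  simp

lemma PolyG.integrable [MeasurableSpace E] {μ : Measure E} [IsFiniteMeasure μ]
    [BorelSpace E] [SecondCountableTopology E]
    (hμ : ∀ p : ℕ, MemLp id (p : ℝ≥0∞) μ) {h : E → F} (hh : PolyG h)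
    (hc : Continuous h) : Integrable h μ := by
  obtain ⟨C, p, hC, H⟩ := hh
  refine ((integrable_one_add_pow hμ p 1).const_mul C).mono'
    hc.aestronglyMeasurable (ae_of_all _ H)
end poly

/-- One-dimensional Gaussian integration by parts. -/
lemma gaussianReal_ibp (v : ℝ≥0) (hv : v ≠ 0) (h h' : ℝ → ℝ) (hd : ∀ x, HasDerivAt h (h' x) x)
    (hc : Continuous h') (hg : PolyG h) (hg' : PolyG h') :
    ∫ z, z * h z ∂(gaussianReal 0 v) = v * ∫ z, h' z ∂(gaussianReal 0 v) := by
  have hmem : ∀ p : ℕ, MemLp id (p : ℝ≥0∞) (gaussianReal 0 v) := fun p =>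
    IsGaussian.memLp_id _ _ (by simp)
  have hhc : Continuous h := continuous_iff_continuousAt.2 fun x => (hd x).continuousAt
  have hI : ∀ k : ℝ → ℝ, PolyG k → Continuous k →
      Integrable (fun x => gaussianPDFReal 0 v x * k x) := by
    intro k hk hkc
    have := hk.integrable hmem hkc
    rw [gaussianReal_of_var_ne_zero _ hv, integrable_withDensity_iff_integrable_smul'
      (measurable_gaussianPDF _ _) (ae_of_all _ fun x => by simp [gaussianPDF])] at this
    simpa [toReal_gaussianPDF] using this
  have hpd : ∀ x, HasDerivAt (gaussianPDFReal 0 v) (-(x / v) * gaussianPDFReal 0 v x) x := by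
    intro x
    rw [gaussianPDFReal_def]
    have : HasDerivAt (fun x : ℝ => -(x - 0) ^ 2 / (2 * (v : ℝ))) (-(x / v)) x := by
      have := (((hasDerivAt_id x).sub_const 0).pow 2).neg.div_const (2 * (v : ℝ))
      refine this.congr_deriv ?_
      have : (v : ℝ) ≠ 0 := by exact_mod_cast hv
      simp only [id, sub_zero]
      field_simp
      norm_num
    refine (this.exp.const_mul _).congr_deriv ?_
    ring
  rw [integral_gaussianReal_eq_integral_smul hv, integral_gaussianReal_eq_integral_smul hv]
  have hv' : (v : ℝ) ≠ 0 := by exact_mod_cast hv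
  have key := integral_mul_deriv_eq_deriv_mul_of_integrable (u := gaussianPDFReal 0 v) (v := h)
    (u' := fun x => -(x / v) * gaussianPDFReal 0 v x) (v' := h')
    (fun x _ => hpd x) (fun x _ => hd x) (hI _ hg' hc) ?_ (hI _ hg hhc)
  · simp only [smul_eq_mul]
    rw [key, ← integral_neg, ← integral_const_mul]
    congr 1
    ext x
    field_simp
  · have := (hI _ (PolyG.norm_id.mul hg) (continuous_id.mul hhc)).const_mul (-(v : ℝ)⁻¹)
    refine this.congr (ae_of_all _ fun x => ?_)
    simp only [Pi.mul_apply]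
    field_simp

structure GaussV (P : Measure Ω) (S : Matrix (Fin n) (Fin n) ℝ) (G : Ω → Fin n → ℝ) : Prop where
  psd : S.PosSemidef
  meas : Measurable G
  law : ∀ v : Fin n → ℝ, Measure.map (fun ω => v ⬝ᵥ G ω) P =
        gaussianReal 0 (Real.toNNReal (v ⬝ᵥ S *ᵥ v))

namespace GaussV
variable {P : Measure Ω} {S : Matrix (Fin n) (Fin n) ℝ} {G : Ω → Fin n → ℝ}

lemma clm_eq (L : (Fin n → ℝ) →L[ℝ] ℝ) (y : Fin n → ℝ) :
    L y = (fun i => L (Pi.single i 1)) ⬝ᵥ y := by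
  conv_lhs => rw [pi_eq_sum_univ' y]
  simp [dotProduct, mul_comm]

lemma hasGaussianLaw (hG : GaussV P S G) : HasGaussianLaw G P := by
  constructor
  refine isGaussian_of_map_eq_gaussianReal fun L => ⟨0,
    Real.toNNReal ((fun i => L (Pi.single i 1)) ⬝ᵥ S *ᵥ (fun i => L (Pi.single i 1))), ?_⟩
  rw [Measure.map_map (by fun_prop) hG.meas]
  have : L ∘ G = fun ω => (fun i => L (Pi.single i 1)) ⬝ᵥ G ω := by
    ext ω; exact clm_eq L _
  rw [this, hG.law]

lemma measDot (hG : GaussV P S G) (v : Fin n → ℝ) : Measurable (fun ω => v ⬝ᵥ G ω) := by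
  have := hG.meas
  unfold dotProduct
  fun_prop

lemma memLp (hG : GaussV P S G) (v : Fin n → ℝ) : MemLp (fun ω => v ⬝ᵥ G ω) 2 P := by
  have h := IsGaussian.memLp_id (gaussianReal 0 (Real.toNNReal (v ⬝ᵥ S *ᵥ v))) 2 (by simp)
  rw [← hG.law v] at h
  exact (memLp_map_measure_iff (by fun_prop) (hG.measDot v).aemeasurable).1 h

lemma nonneg (hG : GaussV P S G) (v : Fin n → ℝ) : 0 ≤ v ⬝ᵥ S *ᵥ v := by
  simpa using hG.psd.dotProduct_mulVec_nonneg v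

lemma var (hG : GaussV P S G) (v : Fin n → ℝ) : Var[fun ω => v ⬝ᵥ G ω; P] = v ⬝ᵥ S *ᵥ v := by
  have h := variance_id_gaussianReal (μ := 0) (v := Real.toNNReal (v ⬝ᵥ S *ᵥ v))
  rw [← hG.law v, variance_map (by fun_prop) (hG.measDot v).aemeasurable] at h
  rw [Real.coe_toNNReal _ (hG.nonneg v)] at h
  exact h

lemma symm (hG : GaussV P S G) (v w : Fin n → ℝ) : v ⬝ᵥ S *ᵥ w = w ⬝ᵥ S *ᵥ v := by
  have : Sᵀ = S := by simpa using hG.psd.1.eq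
  rw [dotProduct_mulVec, ← mulVec_transpose, this, dotProduct_comm]

lemma cov [IsProbabilityMeasure P] (hG : GaussV P S G) (v w : Fin n → ℝ) :
    cov[fun ω => v ⬝ᵥ G ω, fun ω => w ⬝ᵥ G ω; P] = v ⬝ᵥ S *ᵥ w := by
  have h := variance_add (hG.memLp v) (hG.memLp w)
  have : ((fun ω => v ⬝ᵥ G ω) + fun ω => w ⬝ᵥ G ω) = fun ω => (v + w) ⬝ᵥ G ω := by
    ext ω; simp [add_dotProduct]
  rw [this, hG.var, hG.var, hG.var, mulVec_add, add_dotProduct, dotProduct_add, dotProduct_add,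
    hG.symm w v] at h
  linarith

lemma moments (hG : GaussV P S G) (p : ℕ) : MemLp id (p : ℝ≥0∞) (P.map G) := by
  have := hG.hasGaussianLaw.isGaussian_map
  exact IsGaussian.memLp_id _ _ (by simp)

lemma integrable [IsProbabilityMeasure P] (hG : GaussV P S G) {F : Type*} [NormedAddCommGroup F]
    {h : (Fin n → ℝ) → F} (hh : PolyG h) (hc : Continuous h) : Integrable (fun ω => h (G ω)) P := by
  have := Measure.isProbabilityMeasure_map (μ := P) hG.meas.aemeasurable
  exact (hh.integrable hG.moments hc).comp_measurable hG.meas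

/-- Gaussian integration by parts. -/
lemma ibp [IsProbabilityMeasure P] (hG : GaussV P S G) (v : Fin n → ℝ) (g : (Fin n → ℝ) → ℝ)
    (hg : ContDiff ℝ 1 g) (hgg : PolyG g) (hgd : PolyG (fderiv ℝ g)) :
    ∫ ω, (v ⬝ᵥ G ω) * g (G ω) ∂P = ∫ ω, fderiv ℝ g (G ω) (S *ᵥ v) ∂P := by
  have hfc : Continuous (fderiv ℝ g) := hg.continuous_fderiv one_ne_zero
  by_cases h0 : v ⬝ᵥ S *ᵥ v = 0
  · have h1 : S *ᵥ v = 0 := (hG.psd.dotProduct_mulVec_zero_iff v).1 (by simpa using h0)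
    have h2 : ∀ᵐ ω ∂P, v ⬝ᵥ G ω = 0 := by
      have := hG.law v
      rw [h0, Real.toNNReal_zero, gaussianReal_zero_var] at this
      have h3 : ∀ᵐ z ∂(Measure.map (fun ω => v ⬝ᵥ G ω) P), z = 0 := by
        rw [this]
        exact (ae_dirac_iff (p := fun z : ℝ => z = 0) (measurableSet_singleton 0)).2 rfl
      exact ae_of_ae_map (hG.measDot v).aemeasurable h3
    rw [h1]
    simp only [map_zero, integral_zero]
    rw [integral_eq_zero_of_ae]
    filter_upwards [h2] with ω hω
    simp [hω]
  · set s := v ⬝ᵥ S *ᵥ v with hs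
    have hs0 : 0 < s := lt_of_le_of_ne (hG.nonneg v) (Ne.symm h0)
    set c : Fin n → ℝ := s⁻¹ • (S *ᵥ v) with hc
    let lv : (Fin n → ℝ) →L[ℝ] ℝ := LinearMap.toContinuousLinearMap (dotProductBilin ℝ ℝ v)
    have hlv : ∀ y, lv y = v ⬝ᵥ y := fun y => rfl
    let LR : (Fin n → ℝ) →L[ℝ] (Fin n → ℝ) := ContinuousLinearMap.id ℝ _ - lv.smulRight c
    have hLR : ∀ y, LR y = y - (v ⬝ᵥ y) • c := fun y => rfl
    have hpair : HasGaussianLaw (fun ω => (LR (G ω), lv (G ω))) P :=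
      hG.hasGaussianLaw.map_fun (LR.prod lv)
    have hind : IndepFun (fun ω => LR (G ω)) (fun ω => lv (G ω)) P := by
      refine hpair.indepFun_of_covariance_strongDual fun L₁ L₂ => ?_
      have e1 : L₁ ∘ (fun ω => LR (G ω)) =
          fun ω => (fun i => (L₁ ∘L LR) (Pi.single i 1)) ⬝ᵥ G ω := by
        ext ω; exact clm_eq (L₁ ∘L LR) _
      have e2 : L₂ ∘ (fun ω => lv (G ω)) = fun ω => (L₂ 1 • v) ⬝ᵥ G ω := by
        ext ω
        have : L₂ (lv (G ω)) = lv (G ω) * L₂ 1 := by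
          rw [← smul_eq_mul, ← map_smul]; simp
        rw [Function.comp_apply, this, hlv, smul_dotProduct, smul_eq_mul, mul_comm]
      rw [e1, e2, hG.cov, mulVec_smul, dotProduct_smul, ← clm_eq (L₁ ∘L LR)]
      have : LR (S *ᵥ v) = 0 := by
        rw [hLR, ← hs, hc, smul_smul, mul_inv_cancel₀ h0, one_smul, sub_self]
      simp [this]
    have hmR : Measurable (fun ω => LR (G ω)) := LR.measurable.comp hG.meas
    have hml : Measurable (fun ω => lv (G ω)) := lv.measurable.comp hG.meas
    have hmap := (indepFun_iff_map_prod_eq_prod_map_map hmR.aemeasurable hml.aemeasurable).1 hind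
    have hlaw : P.map (fun ω => lv (G ω)) = gaussianReal 0 s.toNNReal := hG.law v
    have hdec : ∀ ω, G ω = LR (G ω) + lv (G ω) • c := by
      intro ω; rw [hLR, hlv]; simp
    have := Measure.isProbabilityMeasure_map (μ := P) hmR.aemeasurable
    rw [hlaw] at hmap
    -- general transfer
    have htr : ∀ F : (Fin n → ℝ) → ℝ → ℝ, Continuous (Function.uncurry F) →
        Integrable (fun ω => F (LR (G ω)) (lv (G ω))) P →
        ∫ ω, F (LR (G ω)) (lv (G ω)) ∂P =
          ∫ r, ∫ z, F r z ∂(gaussianReal 0 s.toNNReal) ∂(P.map (fun ω => LR (G ω))) := by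
      intro F hF hi
      have h1 : Integrable (Function.uncurry F)
          ((P.map (fun ω => LR (G ω))).prod (gaussianReal 0 s.toNNReal)) := by
        rw [← hmap, integrable_map_measure hF.aestronglyMeasurable (by fun_prop)]
        exact hi
      have h2 := integral_prod _ h1
      rw [← hmap, integral_map (by fun_prop) hF.aestronglyMeasurable] at h2
      exact h2
    have i1 : Integrable (fun ω => (v ⬝ᵥ G ω) * g (G ω)) P := by
      refine hG.integrable (h := fun y => lv y * g y) ?_ (lv.continuous.mul hg.continuous)
      refine PolyG.mul ?_ hgg
      exact PolyG.norm_id.comp ‖lv‖ (norm_nonneg _) fun x => (lv.le_opNorm x).trans (by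
        gcongr; linarith)
    have i2 : Integrable (fun ω => fderiv ℝ g (G ω) (S *ᵥ v)) P := 
      (hG.integrable hgd hfc).apply_continuousLinearMap _
    have t1 := htr (fun r z => z * g (r + z • c)) (by
      have := hg.continuous
      unfold Function.uncurry
      fun_prop) (by
        simp only [← hdec]
        exact i1)
    have t2 := htr (fun r z => fderiv ℝ g (r + z • c) (S *ᵥ v)) (by
      unfold Function.uncurry
      fun_prop) (by simpa only [← hdec] using i2)
    simp only [← hdec] at t1 t2
    simp only [← hlv]
    rw [t1, t2]
    congr 1
    ext r
    have hlin : ∀ z : ℝ, ‖r + z • c‖ ≤ (‖r‖ + ‖c‖) * (1 + ‖z‖) := by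
      intro z
      refine (norm_add_le _ _).trans ?_
      rw [norm_smul]
      nlinarith [norm_nonneg r, norm_nonneg c, norm_nonneg z, mul_nonneg (norm_nonneg r) (norm_nonneg z)]
    have hgd' : PolyG (fun z : ℝ => fderiv ℝ g (r + z • c)) := hgd.comp _ (by positivity) hlin
    rw [gaussianReal_ibp s.toNNReal (by simpa using hs0) (fun z => g (r + z • c))
      (fun z => fderiv ℝ g (r + z • c) c)]
    · rw [← integral_const_mul, Real.coe_toNNReal _ hs0.le]
      congr 1
      ext z
      rw [hc, map_smul, smul_eq_mul, ← mul_assoc, mul_inv_cancel₀ h0, one_mul]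
    · intro z
      have h1 : HasDerivAt (fun z : ℝ => r + z • c) c z := by
        simpa using ((hasDerivAt_id z).smul_const c).const_add r
      exact ((hg.differentiable one_ne_zero _).hasFDerivAt).comp_hasDerivAt z h1
    · fun_prop
    · exact hgg.comp _ (by positivity) hlin
    · obtain ⟨C, p, hC, H⟩ := hgd'
      refine ⟨C * ‖c‖, p, by positivity, fun z => (ContinuousLinearMap.le_opNorm _ _).trans ?_⟩
      have := H z
      calc _ ≤ (C * (1 + ‖z‖) ^ p) * ‖c‖ := by gcongr
        _ = _ := by ring
end GaussV

namespace GaussV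
variable {P : Measure Ω} {S : Matrix (Fin n) (Fin n) ℝ} {G : Ω → Fin n → ℝ}

lemma norm_aff_le {E : Type*} [NormedAddCommGroup E] [NormedSpace ℝ E] (y z : E) (b : ℝ) :
    ‖y + b • z‖ ≤ (‖y‖ + |b|) * (1 + ‖z‖) := by
  refine (norm_add_le _ _).trans ?_
  rw [norm_smul, Real.norm_eq_abs]
  nlinarith [norm_nonneg y, abs_nonneg b, norm_nonneg z,
    mul_nonneg (norm_nonneg y) (norm_nonneg z)]

lemma integrable_aff [IsProbabilityMeasure P] (hG : GaussV P S G) {F : Type*}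
    [NormedAddCommGroup F] {h : (Fin n → ℝ) → F} (hh : PolyG h) (hc : Continuous h)
    (y : Fin n → ℝ) (b : ℝ) : Integrable (fun ω => h (y + b • G ω)) P :=
  hG.integrable (h := fun z => h (y + b • z))
    (hh.comp _ (by positivity) fun z => norm_aff_le y z b) (by fun_prop)

/-- derivative of the integrand -/
noncomputable def jD (h : (Fin n → ℝ) → ℝ) (q : (Fin n → ℝ) × ℝ) (z : Fin n → ℝ) :
    ((Fin n → ℝ) × ℝ) →L[ℝ] ℝ :=
  (fderiv ℝ h (q.1 + q.2 • z)).comp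
    (ContinuousLinearMap.fst ℝ (Fin n → ℝ) ℝ +
      (ContinuousLinearMap.snd ℝ (Fin n → ℝ) ℝ).smulRight z)

lemma jD_apply (h : (Fin n → ℝ) → ℝ) (q r : (Fin n → ℝ) × ℝ) (z : Fin n → ℝ) :
    jD h q z r = fderiv ℝ h (q.1 + q.2 • z) (r.1 + r.2 • z) := rfl

lemma jD_bound {h : (Fin n → ℝ) → ℝ} (hd : PolyG (fderiv ℝ h)) (q₀ : (Fin n → ℝ) × ℝ) :
    ∃ (C : ℝ) (p : ℕ), 0 ≤ C ∧ ∀ q ∈ Metric.ball q₀ 1, ∀ z,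
      ‖jD h q z‖ ≤ C * (1 + ‖z‖) ^ p := by
  obtain ⟨C, p, hC, H⟩ := hd
  refine ⟨C * (3 + ‖q₀.1‖ + |q₀.2|) ^ p, p + 1, by positivity, fun q hq z => ?_⟩
  have hq' : ‖q - q₀‖ < 1 := by simpa [dist_eq_norm] using hq
  have h1 : ‖q.1‖ ≤ ‖q₀.1‖ + 1 := by
    have := norm_fst_le (q - q₀)
    have := norm_sub_norm_le q.1 q₀.1
    simp only [Prod.fst_sub] at *
    linarith
  have h2 : |q.2| ≤ |q₀.2| + 1 := by
    have := norm_snd_le (q - q₀)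
    have := norm_sub_norm_le q.2 q₀.2
    simp only [Prod.snd_sub, Real.norm_eq_abs] at *
    linarith
  have h3 : ‖ContinuousLinearMap.fst ℝ (Fin n → ℝ) ℝ +
      (ContinuousLinearMap.snd ℝ (Fin n → ℝ) ℝ).smulRight z‖ ≤ 1 + ‖z‖ := by
    refine ContinuousLinearMap.opNorm_le_bound _ (by positivity) fun r => ?_
    change ‖r.1 + r.2 • z‖ ≤ _
    refine (norm_add_le _ _).trans ?_
    rw [norm_smul]
    have := norm_fst_le r
    have := norm_snd_le r
    nlinarith [norm_nonneg z]
  have h4 : ‖fderiv ℝ h (q.1 + q.2 • z)‖ ≤ C * ((3 + ‖q₀.1‖ + |q₀.2|) * (1 + ‖z‖)) ^ p := by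
    refine (H _).trans ?_
    gcongr
    have := norm_aff_le q.1 z q.2
    nlinarith [norm_nonneg z]
  refine (ContinuousLinearMap.opNorm_comp_le _ _).trans ?_
  calc _ ≤ (C * ((3 + ‖q₀.1‖ + |q₀.2|) * (1 + ‖z‖)) ^ p) * (1 + ‖z‖) := by gcongr
    _ = _ := by rw [mul_pow]; ring

lemma jD_cont {h : (Fin n → ℝ) → ℝ} (hh : ContDiff ℝ 1 h) (q : (Fin n → ℝ) × ℝ) :
    Continuous (jD h q) := by
  have := hh.continuous_fderiv one_ne_zero
  have h2 : Continuous fun z : Fin n → ℝ =>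
      (ContinuousLinearMap.snd ℝ (Fin n → ℝ) ℝ).smulRight z :=
    (ContinuousLinearMap.smulRightL ℝ ((Fin n → ℝ) × ℝ) (Fin n → ℝ)
      (ContinuousLinearMap.snd ℝ (Fin n → ℝ) ℝ)).continuous
  unfold jD
  exact (by fun_prop : Continuous fun z : Fin n → ℝ => fderiv ℝ h (q.1 + q.2 • z)).clm_comp
    (continuous_const.add h2)

lemma jD_int [IsProbabilityMeasure P] (hG : GaussV P S G) {h : (Fin n → ℝ) → ℝ}
    (hh : ContDiff ℝ 1 h) (hd : PolyG (fderiv ℝ h)) (q : (Fin n → ℝ) × ℝ) :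
    Integrable (fun ω => jD h q (G ω)) P := by
  obtain ⟨C, p, hC, H⟩ := jD_bound hd q
  exact hG.integrable ⟨C, p, hC, H q (Metric.mem_ball_self one_pos)⟩ (jD_cont hh q)

lemma hasFDerivAt_joint [IsProbabilityMeasure P] (hG : GaussV P S G) {h : (Fin n → ℝ) → ℝ}
    (hh : ContDiff ℝ 1 h) (hp : PolyG h) (hd : PolyG (fderiv ℝ h)) (q : (Fin n → ℝ) × ℝ) :
    HasFDerivAt (fun q : (Fin n → ℝ) × ℝ => ∫ ω, h (q.1 + q.2 • G ω) ∂P)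
      (∫ ω, jD h q (G ω) ∂P) q := by
  obtain ⟨C, p, hC, H⟩ := jD_bound hd q
  have hGm := hG.meas
  have := Measure.isProbabilityMeasure_map (μ := P) hG.meas.aemeasurable
  refine hasFDerivAt_integral_of_dominated_of_fderiv_le (F' := fun q ω => jD h q (G ω))
    (bound := fun ω => C * (1 + ‖G ω‖) ^ p)
    (Metric.ball_mem_nhds q one_pos) ?_ ?_ ?_ ?_ ?_ ?_
  · exact Eventually.of_forall fun r => (hG.integrable_aff hp hh.continuous _ _).1
  · exact hG.integrable_aff hp hh.continuous _ _
  · exact (hG.jD_int hh hd q).1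
  · exact ae_of_all _ fun ω r hr => H r hr _
  · exact ((integrable_one_add_pow hG.moments p 1).comp_measurable hG.meas).const_mul C
  · refine ae_of_all _ fun ω r _ => ?_
    have h1 : HasFDerivAt (fun q : (Fin n → ℝ) × ℝ => q.1 + q.2 • G ω)
        (ContinuousLinearMap.fst ℝ (Fin n → ℝ) ℝ +
        (ContinuousLinearMap.snd ℝ (Fin n → ℝ) ℝ).smulRight (G ω)) r :=
      (ContinuousLinearMap.fst ℝ (Fin n → ℝ) ℝ +
        (ContinuousLinearMap.snd ℝ (Fin n → ℝ) ℝ).smulRight (G ω)).hasFDerivAt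
    exact ((hh.differentiable one_ne_zero _).hasFDerivAt).comp r h1

lemma joint_apply [IsProbabilityMeasure P] (hG : GaussV P S G) {h : (Fin n → ℝ) → ℝ}
    (hh : ContDiff ℝ 1 h) (hd : PolyG (fderiv ℝ h)) (q r : (Fin n → ℝ) × ℝ) :
    (∫ ω, jD h q (G ω) ∂P) r = ∫ ω, fderiv ℝ h (q.1 + q.2 • G ω) (r.1 + r.2 • G ω) ∂P :=
  ContinuousLinearMap.integral_apply (hG.jD_int hh hd q) r

lemma fderiv_space [IsProbabilityMeasure P] (hG : GaussV P S G) {h : (Fin n → ℝ) → ℝ}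
    (hh : ContDiff ℝ 1 h) (hp : PolyG h) (hd : PolyG (fderiv ℝ h)) (a b : ℝ) (x w : Fin n → ℝ) :
    fderiv ℝ (fun x => ∫ ω, h (a • x + b • G ω) ∂P) x w =
      a * ∫ ω, fderiv ℝ h (a • x + b • G ω) w ∂P := by
  have h1 : HasFDerivAt (fun x : Fin n → ℝ => (a • x, b))
      ((a • ContinuousLinearMap.id ℝ (Fin n → ℝ)).prod 0) x :=
    (a • ContinuousLinearMap.id ℝ (Fin n → ℝ)).hasFDerivAt.prodMk (hasFDerivAt_const b x)
  have h2 := (hG.hasFDerivAt_joint hh hp hd (a • x, b)).comp x h1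
  have h3 : fderiv ℝ (fun x => ∫ ω, h (a • x + b • G ω) ∂P) x = _ := h2.fderiv
  rw [h3, ContinuousLinearMap.comp_apply, hG.joint_apply hh hd]
  simp [integral_const_mul]

end GaussV

namespace GaussV
variable {P : Measure Ω} {S : Matrix (Fin n) (Fin n) ℝ} {G : Ω → Fin n → ℝ}

lemma main [IsProbabilityMeasure P] (hG : GaussV P S G) (f : (Fin n → ℝ) → ℝ)
    (hf : ContDiff ℝ 2 f) (hp : PolyG f) (hp1 : PolyG (fderiv ℝ f))
    (hp2 : PolyG (fderiv ℝ (fderiv ℝ f))) (x : Fin n → ℝ) :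
      f x - (∫ ω, f (G ω) ∂P) =
        ∫ t in Set.Ioi (0 : ℝ),
          (fderiv ℝ (ouSem P G f t) x x -
            ∑ i, ∑ j, S i j *
              fderiv ℝ (fun y => fderiv ℝ (ouSem P G f t) y (Pi.single j 1)) x
                (Pi.single i 1)) := by
  have hf1 : ContDiff ℝ 1 f := hf.of_le (by norm_num)
  have hDf : ContDiff ℝ 1 (fderiv ℝ f) := hf.fderiv_right (by norm_num)
  have hDfc := hDf.continuous
  have hDDfc : Continuous (fderiv ℝ (fderiv ℝ f)) := hDf.continuous_fderiv one_ne_zero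
  let e : Fin n → (Fin n → ℝ) := fun j => Pi.single j 1
  have he : ∀ j, ‖e j‖ ≤ 1 := fun j => by
    refine (pi_norm_le_iff_of_nonneg zero_le_one).2 fun i => ?_
    by_cases h : i = j
    · subst h; simp [e]
    · simp [e, h]
  let d : Fin n → (Fin n → ℝ) → ℝ := fun j y => fderiv ℝ f y (e j)
  have hd : ∀ j, ContDiff ℝ 1 (d j) := fun j => hDf.clm_apply contDiff_const
  have hdp : ∀ j, PolyG (d j) := fun j => hp1.of_le fun y =>
    (ContinuousLinearMap.le_opNorm _ _).trans (mul_le_of_le_one_right (norm_nonneg _) (he j))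
  have hdd : ∀ j y w, fderiv ℝ (d j) y w = fderiv ℝ (fderiv ℝ f) y w (e j) := by
    intro j y w
    have h1 := (hDf.differentiable one_ne_zero y).hasFDerivAt
    have h2 := h1.clm_apply (hasFDerivAt_const (e j) y)
    rw [show fderiv ℝ (d j) y = _ from h2.fderiv]
    simp
  have hddp : ∀ j, PolyG (fderiv ℝ (d j)) := fun j => hp2.of_le fun y => by
    refine ContinuousLinearMap.opNorm_le_bound _ (by positivity) fun w => ?_
    rw [hdd]
    refine (ContinuousLinearMap.le_opNorm _ _).trans ?_
    refine (mul_le_of_le_one_right (norm_nonneg _) (he j)).trans ?_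
    exact ContinuousLinearMap.le_opNorm _ _
  -- the semigroup and its derivatives
  let a : ℝ → ℝ := fun t => Real.exp (-t)
  let b : ℝ → ℝ := fun t => Real.sqrt (1 - Real.exp (-2 * t))
  have hou : ∀ t, ouSem P G f t = fun x => ∫ ω, f (a t • x + b t • G ω) ∂P := fun t => rfl
  have hsp1 : ∀ t y w, fderiv ℝ (ouSem P G f t) y w =
      a t * ∫ ω, fderiv ℝ f (a t • y + b t • G ω) w ∂P := fun t y w => by
    rw [hou]; exact hG.fderiv_space hf1 hp hp1 _ _ _ _
  have hsp2 : ∀ t i j, fderiv ℝ (fun y => fderiv ℝ (ouSem P G f t) y (Pi.single j 1)) x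
      (Pi.single i 1) = a t * (a t * ∫ ω, fderiv ℝ (d j) (a t • x + b t • G ω) (e i) ∂P) := by
    intro t i j
    have h1 : (fun y => fderiv ℝ (ouSem P G f t) y (Pi.single j 1)) =
        fun y => a t * ∫ ω, d j (a t • y + b t • G ω) ∂P := by
      ext y; exact hsp1 t y _
    have h2 := (hG.hasFDerivAt_joint (hd j) (hdp j) (hddp j) (a t • x, b t)).differentiableAt
    have h3 : DifferentiableAt ℝ (fun y => ∫ ω, d j (a t • y + b t • G ω) ∂P) x :=
      DifferentiableAt.comp x (f := fun y : Fin n → ℝ => (a t • y, b t)) h2 (by fun_prop)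
    rw [h1, fderiv_const_mul h3]
    rw [_root_.smul_apply, smul_eq_mul,
      hG.fderiv_space (hd j) (hdp j) (hddp j)]
  let φ : ℝ → ℝ := fun t => ouSem P G f t x
  let ψ : ℝ → ℝ := fun t => a t * ∫ ω, fderiv ℝ f (a t • x + b t • G ω) x ∂P -
    ∑ i, ∑ j, S i j * (a t * (a t * ∫ ω, fderiv ℝ (d j) (a t • x + b t • G ω) (e i) ∂P))
  simp only [hsp2]
  simp only [hsp1]
  change _ = ∫ t in Set.Ioi (0 : ℝ), ψ t
  have hsq : ∀ t, a t * a t = Real.exp (-2 * t) := fun t => by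
    simp only [a]; rw [← Real.exp_add]; ring_nf
  have hSs : ∀ i j, S i j = S j i := fun i j => by
    simpa using congrFun (congrFun hG.psd.1.eq j) i
  have hderiv : ∀ t ∈ Set.Ioi (0 : ℝ), HasDerivAt φ (-ψ t) t := by
    intro t ht
    have hlt : 0 < 1 - Real.exp (-2 * t) := by
      have : Real.exp (-2 * t) < 1 := by
        rw [← Real.exp_zero]; exact Real.exp_lt_exp.2 (by have : 0 < t := ht; linarith)
      linarith
    have hb : 0 < b t := Real.sqrt_pos.2 hlt
    have da : HasDerivAt a (-a t) t := by
      simpa [a] using (hasDerivAt_neg t).exp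
    have db : HasDerivAt b (a t * a t / b t) t := by
      have h1 : HasDerivAt (fun t : ℝ => 1 - Real.exp (-2 * t)) (2 * Real.exp (-2 * t)) t := by
        refine ((((hasDerivAt_id t).const_mul (-2)).exp).const_sub 1).congr_deriv ?_
        simp; ring
      refine (h1.sqrt hlt.ne').congr_deriv ?_
      rw [hsq]
      change _ / (2 * b t) = _
      field_simp
    have h1 : HasDerivAt (fun t => (a t • x, b t)) ((-a t) • x, a t * a t / b t) t :=
      (da.smul_const x).prodMk db
    have h2 := (hG.hasFDerivAt_joint hf1 hp hp1 (a t • x, b t)).comp_hasDerivAt t h1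
    refine HasDerivAt.congr_deriv (f := φ) h2 ?_
    rw [hG.joint_apply hf1 hp1]
    simp only [ψ]
    -- split
    have hi1 : Integrable (fun ω => fderiv ℝ f (a t • x + b t • G ω)) P :=
      hG.integrable_aff hp1 hDfc _ _
    have hi2 : ∀ i, Integrable (fun ω => G ω i * d i (a t • x + b t • G ω)) P := fun i => by
      refine hG.integrable (h := fun z => z i * d i (a t • x + b t • z)) (PolyG.mul ?_ ?_) ?_
      · exact PolyG.norm_id.of_le fun z => norm_le_pi_norm z i
      · exact (hdp i).comp _ (by positivity) fun z => norm_aff_le _ z _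
      · have := (hd i).continuous
        fun_prop
    have hexp : ∀ ω, fderiv ℝ f (a t • x + b t • G ω) ((-a t) • x + (a t * a t / b t) • G ω) =
        (-a t) * fderiv ℝ f (a t • x + b t • G ω) x +
          (a t * a t / b t) * ∑ i, G ω i * d i (a t • x + b t • G ω) := by
      intro ω
      rw [map_add, map_smul, map_smul, smul_eq_mul, smul_eq_mul,
        clm_eq (fderiv ℝ f (a t • x + b t • G ω)) (G ω)]
      simp only [dotProduct, d, e, mul_comm]
    have hibp : ∀ i, ∫ ω, G ω i * d i (a t • x + b t • G ω) ∂P =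
        b t * ∑ j, S j i * ∫ ω, fderiv ℝ (d i) (a t • x + b t • G ω) (e j) ∂P := by
      intro i
      have hin : ∀ z : Fin n → ℝ, HasFDerivAt (fun z : Fin n → ℝ => a t • x + b t • z)
          (b t • ContinuousLinearMap.id ℝ (Fin n → ℝ)) z := fun z =>
        (b t • ContinuousLinearMap.id ℝ (Fin n → ℝ)).hasFDerivAt.const_add _
      have hgd : ∀ z, fderiv ℝ (fun z => d i (a t • x + b t • z)) z =
          b t • fderiv ℝ (d i) (a t • x + b t • z) := fun z => by
        have := (((hd i).differentiable one_ne_zero _).hasFDerivAt).comp z (hin z)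
        rw [show fderiv ℝ (fun z => d i (a t • x + b t • z)) z = _ from this.fderiv]
        ext w
        simp
      have := hG.ibp (e i) (fun z => d i (a t • x + b t • z))
        ((hd i).comp (by fun_prop)) ((hdp i).comp _ (by positivity) fun z => norm_aff_le _ z _) (by
          have h3 := (hddp i).comp (‖a t • x‖ + |b t|) (by positivity)
            fun z => norm_aff_le (a t • x) z (b t)
          obtain ⟨C, p, hC, H⟩ := h3
          refine ⟨|b t| * C, p, by positivity, fun z => ?_⟩
          rw [hgd, norm_smul, Real.norm_eq_abs, mul_assoc]
          gcongr
          exact H z)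
      simp only [e, single_dotProduct, one_mul] at this
      rw [this]
      simp only [hgd, _root_.smul_apply, smul_eq_mul]
      rw [integral_const_mul]
      congr 1
      have hInteg : ∀ j, Integrable (fun ω => fderiv ℝ (d i) (a t • x + b t • G ω) (e j)) P :=
        fun j => (hG.integrable_aff (hddp i) ((hd i).continuous_fderiv one_ne_zero)
          _ _).apply_continuousLinearMap _
      simp only [← integral_const_mul]
      rw [← integral_finsetSum _ fun j _ => (hInteg j).const_mul _]
      congr 1
      ext ω
      rw [clm_eq]
      simp [dotProduct, e, mul_comm]
    simp only [hexp]
    rw [integral_add ((hi1.apply_continuousLinearMap x).const_mul _)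
      ((integrable_finsetSum _ fun i _ => hi2 i).const_mul _), integral_const_mul,
      integral_const_mul, integral_finsetSum _ fun i _ => hi2 i]
    simp only [hibp]
    rw [← Finset.mul_sum, ← mul_assoc, div_mul_cancel₀ _ hb.ne', Finset.sum_comm, Finset.mul_sum]
    simp only [Finset.mul_sum]
    rw [neg_sub, sub_eq_neg_add, neg_mul]
    congr 1
    refine Finset.sum_congr rfl fun i _ => Finset.sum_congr rfl fun j _ => ?_
    ring
  -- continuity and limits
  have hcontJ := fun q => (hG.hasFDerivAt_joint hf1 hp hp1 q).continuousAt
  have hac : Continuous a := by fun_prop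
  have hbc : Continuous b := by fun_prop
  have hcont : ContinuousWithinAt φ (Set.Ici 0) 0 := by
    refine ContinuousAt.continuousWithinAt ?_
    exact ContinuousAt.comp (f := fun t => (a t • x, b t)) (hcontJ _) (by fun_prop)
  have hφ0 : φ 0 = f x := by simp [φ, ouSem]
  have hlim : Tendsto φ atTop (𝓝 (∫ ω, f (G ω) ∂P)) := by
    have ha : Tendsto a atTop (𝓝 0) := Real.tendsto_exp_neg_atTop_nhds_zero
    have hb : Tendsto b atTop (𝓝 1) := by
      have h1 : Tendsto (fun t => Real.sqrt (1 - a t * a t)) atTop (𝓝 (Real.sqrt (1 - 0 * 0))) :=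
        ((ha.mul ha).const_sub 1).sqrt
      simp only [hsq, mul_zero, sub_zero, Real.sqrt_one] at h1
      exact h1
    have h2 : Tendsto (fun t => (a t • x, b t)) atTop (𝓝 ((0 : ℝ) • x, (1 : ℝ))) :=
      (ha.smul_const x).prodMk_nhds hb
    have h3 := (hcontJ ((0 : ℝ) • x, (1 : ℝ))).tendsto.comp h2
    have h4 : (∫ ω, f ((0:ℝ) • x + (1:ℝ) • G ω) ∂P) = ∫ ω, f (G ω) ∂P := by simp
    rw [← h4]; exact h3
  -- integrability
  have hInteg : IntegrableOn (fun t => -ψ t) (Set.Ioi 0) := by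
    have hbd : ∀ {F : Type _} [NormedAddCommGroup F] (h : (Fin n → ℝ) → F), PolyG h →
        ∃ M : ℝ, 0 ≤ M ∧ ∀ t ∈ Set.Ioi (0 : ℝ), ∫ ω, ‖h (a t • x + b t • G ω)‖ ∂P ≤ M := by
      intro F _ h hh
      obtain ⟨C, p, hC, H⟩ := hh
      have := Measure.isProbabilityMeasure_map (μ := P) hG.meas.aemeasurable
      refine ⟨∫ ω, C * (1 + ‖x‖ + ‖G ω‖) ^ p ∂P, integral_nonneg fun ω => by positivity,
        fun t ht => ?_⟩
      refine integral_mono_of_nonneg (ae_of_all _ fun ω => norm_nonneg _)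
        (((integrable_one_add_pow hG.moments p _).comp_measurable hG.meas).const_mul C)
        (ae_of_all _ fun ω => (H _).trans ?_)
      have ha1 : ‖a t‖ ≤ 1 := by
        rw [Real.norm_eq_abs, abs_of_pos (Real.exp_pos _)]
        exact Real.exp_le_one_iff.2 (by have : 0 < t := ht; linarith)
      have hb1 : ‖b t‖ ≤ 1 := by
        rw [Real.norm_eq_abs, abs_of_nonneg (Real.sqrt_nonneg _)]
        exact Real.sqrt_le_one.2 (by linarith [Real.exp_pos (-2 * t)])
      have h5 : ‖a t • x + b t • G ω‖ ≤ ‖x‖ + ‖G ω‖ := by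
        refine (norm_add_le _ _).trans ?_
        rw [norm_smul, norm_smul]
        exact add_le_add (mul_le_of_le_one_left (norm_nonneg _) ha1)
          (mul_le_of_le_one_left (norm_nonneg _) hb1)
      dsimp only
      gcongr C * ?_ ^ p
      linarith
    obtain ⟨M, hM, HM⟩ := hbd (fun y => fderiv ℝ f y x) (by
      obtain ⟨C, p, hC, H⟩ := hp1
      refine ⟨C * ‖x‖, p, by positivity, fun z => (ContinuousLinearMap.le_opNorm _ _).trans ?_⟩
      have := H z
      calc _ ≤ (C * (1 + ‖z‖) ^ p) * ‖x‖ := by gcongr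
        _ = _ := by ring)
    have hbd2 := fun i j => hbd (fun y => fderiv ℝ (d j) y (e i)) ((hddp j).of_le fun y =>
      (ContinuousLinearMap.le_opNorm _ _).trans (mul_le_of_le_one_right (norm_nonneg _) (he i)))
    choose N hN HN using hbd2
    have hmeas : AEStronglyMeasurable (fun t => -ψ t) (volume.restrict (Set.Ioi 0)) := by
      refine (measurable_deriv φ).aestronglyMeasurable.congr ?_
      filter_upwards [ae_restrict_mem measurableSet_Ioi] with t ht
      exact (hderiv t ht).deriv
    refine Integrable.mono' (g := fun t => (M + ∑ i, ∑ j, |S i j| * N i j) * Real.exp (-t))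
      (((integrableOn_exp_neg_Ioi 0)).const_mul _) hmeas ?_
    filter_upwards [ae_restrict_mem measurableSet_Ioi] with t ht
    have hapos : 0 < a t := Real.exp_pos _
    have ha1 : a t ≤ 1 := Real.exp_le_one_iff.2 (by have : 0 < t := ht; linarith)
    rw [norm_neg]
    change _ ≤ _ * a t
    refine (norm_sub_le _ _).trans ?_
    rw [add_mul, Finset.sum_mul]
    refine add_le_add ?_ ((norm_sum_le _ _).trans (Finset.sum_le_sum fun i _ => ?_))
    · rw [norm_mul, Real.norm_eq_abs (a t), abs_of_pos hapos, mul_comm]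
      gcongr
      exact (norm_integral_le_integral_norm _).trans (HM t ht)
    · rw [Finset.sum_mul]
      refine (norm_sum_le _ _).trans (Finset.sum_le_sum fun j _ => ?_)
      rw [norm_mul, norm_mul, norm_mul, Real.norm_eq_abs (a t), abs_of_pos hapos,
        Real.norm_eq_abs (S i j), mul_assoc]
      refine mul_le_mul_of_nonneg_left ?_ (abs_nonneg _)
      have h6 := (norm_integral_le_integral_norm _).trans (HN i j t ht)
      rw [mul_comm (N i j)]
      refine mul_le_mul_of_nonneg_left ?_ hapos.le
      exact (mul_le_of_le_one_left (norm_nonneg _) ha1).trans h6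
  have hfin := integral_Ioi_of_hasDerivAt_of_tendsto hcont hderiv hInteg hlim
  rw [integral_neg, hφ0] at hfin
  linarith

end GaussV

end aux

theorem stein_equation (P : Measure Ω) [IsProbabilityMeasure P]
    (S : Matrix (Fin n) (Fin n) ℝ) (hS : S.PosSemidef)
    (G : Ω → Fin n → ℝ) (hGmeas : Measurable G)
    (hGgauss : ∀ v : Fin n → ℝ,
      Measure.map (fun ω => ∑ i, v i * G ω i) P =
        gaussianReal 0 (Real.toNNReal (∑ i, ∑ j, v i * S i j * v j)))
    (f : (Fin n → ℝ) → ℝ) (hf : ContDiff ℝ 2 f)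
    (hgrowth : ∃ (C : ℝ) (p : ℕ), ∀ x : Fin n → ℝ,
      |f x| + ‖fderiv ℝ f x‖ + ‖iteratedFDeriv ℝ 2 f x‖ ≤ C * (1 + ‖x‖) ^ p) :
    ∀ x : Fin n → ℝ,
      f x - (∫ ω, f (G ω) ∂P) =
        ∫ t in Set.Ioi (0 : ℝ),
          (fderiv ℝ (ouSem P G f t) x x -
            ∑ i, ∑ j, S i j *
              fderiv ℝ (fun y => fderiv ℝ (ouSem P G f t) y (Pi.single j 1)) x
                (Pi.single i 1)) := by

  obtain ⟨C, p, H⟩ := hgrowth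
  have hC : 0 ≤ C := by
    have := H 0
    simp only [norm_zero, add_zero, one_pow, mul_one] at this
    have h2 : 0 ≤ |f 0| + ‖fderiv ℝ f 0‖ + ‖iteratedFDeriv ℝ 2 f 0‖ := by positivity
    linarith
  have hG : GaussV P S G := by
    refine ⟨hS, hGmeas, fun v => ?_⟩
    have h1 := hGgauss v
    have h2 : (∑ i, ∑ j, v i * S i j * v j) = dotProduct v (S.mulVec v) := by
      simp only [dotProduct, Matrix.mulVec, Finset.mul_sum, mul_assoc]
    rw [h2] at h1
    exact h1
  refine hG.main f hf ⟨C, p, hC, fun x => ?_⟩ ⟨C, p, hC, fun x => ?_⟩ ⟨C, p, hC, fun x => ?_⟩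
  · have := H x
    rw [Real.norm_eq_abs]
    linarith [norm_nonneg (fderiv ℝ f x), norm_nonneg (iteratedFDeriv ℝ 2 f x)]
  · have := H x
    linarith [abs_nonneg (f x), norm_nonneg (iteratedFDeriv ℝ 2 f x)]
  · have := H x
    have h3 : ‖fderiv ℝ (fderiv ℝ f) x‖ = ‖iteratedFDeriv ℝ 2 f x‖ := by
      have h4 := norm_iteratedFDeriv_fderiv (𝕜 := ℝ) (f := f) (n := 1) (x := x)
      rw [← norm_iteratedFDeriv_one, h4]
    rw [h3]
    linarith [abs_nonneg (f x), norm_nonneg (fderiv ℝ f x)]
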